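/- arXiv:1208.5150 — 6 statements merged into one kernel-verified Lean document; each statement's English description precedes it below -/
import Mathlib

section
/- Let D be an n×n spherical Euclidean distance matrix generated by points that lie on a hypersphere of radius ρ whose center lies in the affine span of the points. Then λ* = 2ρ² is the minimum value of λ such that λE − D is positive semidefinite; that is, 2ρ²E − D is positive semidefinite, and every real λ for which λE − D is positive semidefinite satisfies λ ≥ 2ρ². -/
open Matrix

noncomputable section

/-- The n×n all-ones matrix. -/
def onesMat (n : ℕ) : Matrix (Fin n) (Fin n) ℝ := Matrix.of fun _ _ => 1

lemma onesMat_mulVec {n : ℕ} (w : Fin n → ℝ) : onesMat n *ᵥ w = fun _ => ∑ i, w i := by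
  ext i
  simp [onesMat, mulVec, dotProduct]

/-- For points at distance `ρ` from `c`, the matrix `λE - D` is `(λ - 2ρ²)E` plus twice the Gram
matrix of the points relative to `c`. -/
lemma smul_onesMat_sub_eq_add_gram {V : Type*} [NormedAddCommGroup V] [InnerProductSpace ℝ V]
    {n : ℕ} {D : Matrix (Fin n) (Fin n) ℝ} {p : Fin n → V} {c : V} {ρ : ℝ}
    (hD : ∀ i j, D i j = ‖p i - p j‖ ^ 2) (hc : ∀ i, dist (p i) c = ρ) (lam : ℝ) :
    lam • onesMat n - D =
      (lam - 2 * ρ ^ 2) • onesMat n + (2 : ℝ) • gram ℝ (fun i => p i - c) := by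
  ext i j
  have h : ‖p i - p j‖ ^ 2 = ρ ^ 2 - 2 * inner ℝ (p i - c) (p j - c) + ρ ^ 2 := by
    rw [← sub_sub_sub_cancel_right (p i) (p j) c, norm_sub_sq_real, ← dist_eq_norm,
      ← dist_eq_norm, hc, hc]
  simp only [Matrix.sub_apply, Matrix.add_apply, Matrix.smul_apply, onesMat, of_apply,
    gram_apply, smul_eq_mul, hD, h]
  ring

/-- A point of the affine span of a finite family is the origin of a weighted centering of it. -/
lemma exists_sum_smul_sub_eq_zero {V ι : Type*} [AddCommGroup V] [Module ℝ V] [Fintype ι]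
    {p : ι → V} {c : V} (hc : c ∈ affineSpan ℝ (Set.range p)) :
    ∃ w : ι → ℝ, ∑ i, w i = 1 ∧ ∑ i, w i • (p i - c) = 0 := by
  obtain ⟨w, hw, hcw⟩ := eq_affineCombination_of_mem_affineSpan_of_fintype hc
  refine ⟨w, hw, ?_⟩
  rw [Finset.affineCombination_eq_linear_combination _ _ _ hw] at hcw
  simp_rw [smul_sub]
  rw [Finset.sum_sub_distrib, ← Finset.sum_smul, hw, one_smul, ← hcw, sub_self]

theorem min_lambda_eq_two_rho_sq {n : ℕ} (hn : 0 < n)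
    (D : Matrix (Fin n) (Fin n) ℝ) (ρ : ℝ)
    (h : ∃ (r : ℕ) (p : Fin n → EuclideanSpace ℝ (Fin r)),
      (∀ i j, D i j = ‖p i - p j‖ ^ 2) ∧
      ∃ c ∈ affineSpan ℝ (Set.range p), ∀ i, dist (p i) c = ρ) :
    ((2 * ρ ^ 2) • onesMat n - D).PosSemidef ∧
      ∀ lam : ℝ, (lam • onesMat n - D).PosSemidef → 2 * ρ ^ 2 ≤ lam := by
  obtain ⟨r, p, hD, c, hc, hρ⟩ := h
  constructor
  · rw [smul_onesMat_sub_eq_add_gram hD hρ, sub_self, zero_smul, zero_add]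
    exact (posSemidef_gram ℝ _).smul zero_le_two
  · intro lam hlam
    obtain ⟨w, hw, hw0⟩ := exists_sum_smul_sub_eq_zero hc
    have hq := hlam.dotProduct_mulVec_nonneg w
    rw [smul_onesMat_sub_eq_add_gram hD hρ, add_mulVec, smul_mulVec, smul_mulVec, dotProduct_add,
      dotProduct_smul, dotProduct_smul, star_dotProduct_gram_mulVec, hw0, onesMat_mulVec, hw] at hq
    simpa [dotProduct, hw] using hq
end
end

section
/- Let D ≠ 0 be an n×n Euclidean distance matrix. Then D is spherical (i.e., generated by points lying on a common hypersphere) if and only if there exists a real scalar λ such that λ eeᵀ − D is positive semidefinite, where e is the all-ones vector in ℝ^n. -/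
open Matrix

noncomputable section

/-- `p` is a configuration of points generating `D` as a Euclidean distance matrix. -/
def IsEDMGen {n r : ℕ} (D : Matrix (Fin n) (Fin n) ℝ)
    (p : Fin n → EuclideanSpace ℝ (Fin r)) : Prop :=
  ∀ i j, D i j = ‖p i - p j‖ ^ 2

/-- `D` is a Euclidean distance matrix. -/
def IsEDM {n : ℕ} (D : Matrix (Fin n) (Fin n) ℝ) : Prop :=
  ∃ (r : ℕ) (p : Fin n → EuclideanSpace ℝ (Fin r)), IsEDMGen D p

/-- `D` is a spherical EDM: it is generated by points lying on a common hypersphere. -/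
def IsSphericalEDM {n : ℕ} (D : Matrix (Fin n) (Fin n) ℝ) : Prop :=
  ∃ (r : ℕ) (p : Fin n → EuclideanSpace ℝ (Fin r)), IsEDMGen D p ∧
    ∃ (c : EuclideanSpace ℝ (Fin r)) (ρ : ℝ), ∀ i, dist (p i) c = ρ

/-- On the sphere of radius `ρ` about `c`, the matrix `(2 * ρ ^ 2) • eeᵀ - D` is twice a Gram matrix. -/
theorem shift_eq_two_smul_gram {n r : ℕ} {D : Matrix (Fin n) (Fin n) ℝ}
    {p : Fin n → EuclideanSpace ℝ (Fin r)} (hp : IsEDMGen D p)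
    {c : EuclideanSpace ℝ (Fin r)} {ρ : ℝ} (hc : ∀ i, dist (p i) c = ρ) :
    (2 * ρ ^ 2) • onesMat n - D = (2 : ℝ) • gram ℝ (fun i => p i - c) := by
  ext i j
  have h := norm_sub_sq_real (p i - c) (p j - c)
  rw [sub_sub_sub_cancel_right, ← dist_eq_norm (p i) c, ← dist_eq_norm (p j) c, hc, hc] at h
  simp only [Matrix.sub_apply, Matrix.smul_apply, onesMat, Matrix.of_apply, smul_eq_mul,
    gram_apply, hp i j, h]
  ring

open scoped MatrixOrder Matrix.Norms.L2Operator in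
/-- A real positive semidefinite matrix of size `n` is a Gram matrix of vectors in `ℝⁿ`. -/
theorem exists_eq_gram_of_posSemidef {n : ℕ} {G : Matrix (Fin n) (Fin n) ℝ}
    (hG : G.PosSemidef) : ∃ q : Fin n → EuclideanSpace ℝ (Fin n), G = gram ℝ q := by
  obtain ⟨B, rfl⟩ := CStarAlgebra.nonneg_iff_eq_star_mul_self.mp hG.nonneg
  refine ⟨fun i => WithLp.toLp 2 (fun k => B k i), ?_⟩
  ext i j
  simp [star_eq_conjTranspose, Matrix.mul_apply, gram_apply, PiLp.inner_apply, mul_comm]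

theorem IsEDM.diag_eq_zero {n : ℕ} {D : Matrix (Fin n) (Fin n) ℝ} (hD : IsEDM D) (i : Fin n) :
    D i i = 0 := by
  obtain ⟨r, p, hp⟩ := hD
  simp [hp i i]

theorem spherical_iff_exists_psd_shift {n : ℕ}
    (D : Matrix (Fin n) (Fin n) ℝ) (hD : IsEDM D) (hne : D ≠ 0) :
    IsSphericalEDM D ↔ ∃ lam : ℝ, (lam • onesMat n - D).PosSemidef := by
  constructor
  · rintro ⟨r, p, hp, c, ρ, hc⟩
    refine ⟨2 * ρ ^ 2, ?_⟩
    rw [shift_eq_two_smul_gram hp hc]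
    exact (posSemidef_gram ℝ _).smul zero_le_two
  · rintro ⟨lam, h⟩
    have hhalf : ((2⁻¹ : ℝ) • (lam • onesMat n - D)).PosSemidef := h.smul (by norm_num)
    obtain ⟨q, hq⟩ := exists_eq_gram_of_posSemidef hhalf
    have hinner (i j) : inner ℝ (q i) (q j) = 2⁻¹ * (lam - D i j) := by
      simpa [onesMat, gram_apply] using (congrFun₂ hq i j).symm
    have hnorm (i) : ‖q i‖ ^ 2 = 2⁻¹ * lam := by
      rw [← real_inner_self_eq_norm_sq, hinner, hD.diag_eq_zero, sub_zero]
    refine ⟨n, q, fun i j => ?_, 0, √(2⁻¹ * lam), fun i => ?_⟩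
    · rw [norm_sub_sq_real, hinner, hnorm, hnorm]
      ring
    · rw [dist_zero_right, ← hnorm i, Real.sqrt_sq (norm_nonneg _)]
end
end

section
/- Let D ≠ 0 be an n×n Euclidean distance matrix of embedding dimension r. Then D is spherical (i.e., generated by points lying on a common hypersphere) if and only if rank(D) = r + 1. -/
open Matrix

noncomputable section

/-- `D` is a Euclidean distance matrix of embedding dimension `d`. -/
def IsEDMOfDim {n : ℕ} (D : Matrix (Fin n) (Fin n) ℝ) (d : ℕ) : Prop :=
  ∃ (r : ℕ) (p : Fin n → EuclideanSpace ℝ (Fin r)), IsEDMGen D p ∧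
    Module.finrank ℝ (affineSpan ℝ (Set.range p)).direction = d

open scoped InnerProductSpace

/-- The affine dependencies of a finite family `p`: weights `x` with `∑ x i = 0` and
`∑ x i • p i = 0`. -/
def affineDependencies {n : ℕ} {E : Type*} [AddCommGroup E] [Module ℝ E] (p : Fin n → E) :
    Submodule ℝ (Fin n → ℝ) :=
  LinearMap.ker (Fintype.linearCombination ℝ (fun _ : Fin n => (1 : ℝ))) ⊓
    LinearMap.ker (Fintype.linearCombination ℝ p)

theorem mem_affineDependencies {n : ℕ} {E : Type*} [AddCommGroup E] [Module ℝ E]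
    {p : Fin n → E} {x : Fin n → ℝ} :
    x ∈ affineDependencies p ↔ ∑ i, x i = 0 ∧ ∑ i, x i • p i = 0 := by
  simp [affineDependencies, Fintype.linearCombination_apply]

theorem map_ker_sum_eq_vectorSpan {n : ℕ} {E : Type*} [AddCommGroup E] [Module ℝ E]
    (p : Fin n → E) :
    (LinearMap.ker (Fintype.linearCombination ℝ (fun _ : Fin n => (1 : ℝ)))).map
      (Fintype.linearCombination ℝ p) = vectorSpan ℝ (Set.range p) := by
  apply le_antisymm
  · rintro _ ⟨x, hx, rfl⟩
    have hx' : ∑ i, x i = 0 := by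
      simpa [Fintype.linearCombination_apply] using hx
    have h := weightedVSub_mem_vectorSpan (k := ℝ) (s := Finset.univ) hx' p
    rwa [Finset.weightedVSub_eq_linear_combination _ hx'] at h
  · rw [vectorSpan_def, Submodule.span_le]
    rintro _ ⟨_, ⟨i, rfl⟩, _, ⟨j, rfl⟩, rfl⟩
    refine ⟨Pi.single i 1 - Pi.single j 1, ?_, ?_⟩
    · simp [map_sub, Fintype.linearCombination_apply_single]
    · simp [map_sub, Fintype.linearCombination_apply_single]

theorem finrank_affineDependencies_add {n : ℕ} [NeZero n] {E : Type*} [AddCommGroup E]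
    [Module ℝ E] (p : Fin n → E) :
    Module.finrank ℝ (affineDependencies p) +
      (Module.finrank ℝ (vectorSpan ℝ (Set.range p)) + 1) = n := by
  set s := Fintype.linearCombination ℝ (fun _ : Fin n => (1 : ℝ)) with hs
  set T := Fintype.linearCombination ℝ p
  have h1 := s.finrank_range_add_finrank_ker
  have hsurj : LinearMap.range s = ⊤ := by
    rw [LinearMap.range_eq_top]
    intro y
    exact ⟨Pi.single 0 y, by simp [hs, Fintype.linearCombination_apply_single]⟩
  rw [hsurj, finrank_top, Module.finrank_self, Module.finrank_fin_fun] at h1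
  have h2 := (T.domRestrict (LinearMap.ker s)).finrank_range_add_finrank_ker
  have h3 : Module.finrank ℝ (LinearMap.ker (T.domRestrict (LinearMap.ker s))) =
      Module.finrank ℝ (affineDependencies p) := by
    rw [← Submodule.finrank_map_subtype_eq, LinearMap.ker_domRestrict,
      Submodule.map_comap_subtype]
    rfl
  rw [LinearMap.range_domRestrict, map_ker_sum_eq_vectorSpan, h3] at h2
  omega

section Gen

variable {n r : ℕ} {D : Matrix (Fin n) (Fin n) ℝ} {p : Fin n → EuclideanSpace ℝ (Fin r)}

theorem IsEDMGen.isSymm (h : IsEDMGen D p) : Dᵀ = D := by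
  ext i j
  rw [Matrix.transpose_apply, h, h, norm_sub_rev]

theorem IsEDMGen.mulVec_apply (h : IsEDMGen D p) (c : EuclideanSpace ℝ (Fin r))
    (x : Fin n → ℝ) (i : Fin n) :
    (D *ᵥ x) i = ‖p i - c‖ ^ 2 * ∑ j, x j + ∑ j, x j * ‖p j - c‖ ^ 2 -
      2 * ⟪p i - c, ∑ j, x j • (p j - c)⟫_ℝ := by
  simp only [Matrix.mulVec, dotProduct, inner_sum, inner_smul_right, Finset.mul_sum]
  rw [← Finset.sum_add_distrib, ← Finset.sum_sub_distrib]
  refine Finset.sum_congr rfl fun j _ => ?_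
  rw [h, ← sub_sub_sub_cancel_right (p i) (p j) c, norm_sub_sq_real]
  ring

theorem IsEDMGen.dotProduct_mulVec (h : IsEDMGen D p) {x : Fin n → ℝ} (hx : ∑ i, x i = 0) :
    x ⬝ᵥ D *ᵥ x = -2 * ‖∑ i, x i • p i‖ ^ 2 := by
  have h0 : ∀ i, (D *ᵥ x) i = ∑ j, x j * ‖p j‖ ^ 2 - 2 * ⟪p i, ∑ j, x j • p j⟫_ℝ := by
    intro i
    simpa [hx] using h.mulVec_apply 0 x i
  have h1 : ⟪∑ i, x i • p i, ∑ j, x j • p j⟫_ℝ = ∑ i, x i * ⟪p i, ∑ j, x j • p j⟫_ℝ := by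
    simp only [sum_inner, inner_smul_left]
    rfl
  simp only [dotProduct, h0, mul_sub, Finset.sum_sub_distrib]
  rw [← Finset.sum_mul, hx, zero_mul, zero_sub, ← real_inner_self_eq_norm_sq, h1, Finset.mul_sum,
    ← Finset.sum_neg_distrib]
  exact Finset.sum_congr rfl fun i _ => by ring

theorem IsEDMGen.mem_affineDependencies_iff (h : IsEDMGen D p) {x : Fin n → ℝ} :
    x ∈ affineDependencies p ↔ ∑ i, x i = 0 ∧ x ⬝ᵥ D *ᵥ x = 0 := by
  rw [mem_affineDependencies]
  refine and_congr_right fun hx => ?_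
  simp [h.dotProduct_mulVec hx]

theorem IsEDMGen.affineDependencies_eq (h : IsEDMGen D p) {m : ℕ}
    {q : Fin n → EuclideanSpace ℝ (Fin m)} (hq : IsEDMGen D q) :
    affineDependencies p = affineDependencies q := by
  ext x
  rw [h.mem_affineDependencies_iff, hq.mem_affineDependencies_iff]

/-- If `D w` is a nonzero constant vector, then the kernel of `D` consists of affine
dependencies. -/
theorem IsEDMGen.ker_le_affineDependencies (h : IsEDMGen D p) {w : Fin n → ℝ} {a : ℝ}
    (ha : a ≠ 0) (hw : D *ᵥ w = fun _ => a) :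
    LinearMap.ker D.mulVecLin ≤ affineDependencies p := by
  intro x hx
  have hx' : D *ᵥ x = 0 := by simpa using hx
  refine h.mem_affineDependencies_iff.2 ⟨?_, by simp [hx']⟩
  have h1 : w ⬝ᵥ D *ᵥ x = (D *ᵥ w) ⬝ᵥ x := by
    rw [Matrix.dotProduct_mulVec, ← Matrix.mulVec_transpose, h.isSymm]
  rw [hx', hw, dotProduct_zero] at h1
  simp only [dotProduct, ← Finset.mul_sum] at h1
  exact (mul_eq_zero.1 h1.symm).resolve_left ha

theorem IsEDMGen.mulVec_of_mem_affineDependencies (h : IsEDMGen D p)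
    (c : EuclideanSpace ℝ (Fin r)) {x : Fin n → ℝ} (hx : x ∈ affineDependencies p) :
    D *ᵥ x = fun _ => ∑ j, x j * ‖p j - c‖ ^ 2 := by
  obtain ⟨h1, h2⟩ := mem_affineDependencies.1 hx
  ext i
  rw [h.mulVec_apply c]
  simp [smul_sub, ← Finset.sum_smul, h1, h2]

theorem IsEDMGen.ker_eq_affineDependencies_of_dist_eq [NeZero n] (h : IsEDMGen D p) (hne : D ≠ 0)
    {c : EuclideanSpace ℝ (Fin r)} {ρ : ℝ} (hc : ∀ i, dist (p i) c = ρ) :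
    LinearMap.ker D.mulVecLin = affineDependencies p := by
  have hnonempty : Nonempty (affineSpan ℝ (Set.range p)) :=
    ⟨⟨p 0, subset_affineSpan ℝ _ ⟨0, rfl⟩⟩⟩
  obtain ⟨ρ', hρ'⟩ := (EuclideanGeometry.exists_dist_eq_iff_exists_dist_orthogonalProjection_eq
    (subset_affineSpan ℝ (Set.range p)) c).1 ⟨ρ, by rintro _ ⟨i, rfl⟩; exact hc i⟩
  set o : EuclideanSpace ℝ (Fin r) :=
    ↑(EuclideanGeometry.orthogonalProjection (affineSpan ℝ (Set.range p)) c)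
  have hdist : ∀ i, ‖p i - o‖ = ρ' := fun i => by
    rw [← dist_eq_norm]; exact hρ' _ ⟨i, rfl⟩
  have hmem : o ∈ affineSpan ℝ (Set.range p) := SetLike.coe_mem _
  obtain ⟨w, hw, hwo⟩ := eq_affineCombination_of_mem_affineSpan_of_fintype hmem
  rw [Finset.affineCombination_eq_linear_combination _ _ _ hw] at hwo
  have hρ : ρ' ≠ 0 := by
    rintro rfl
    refine hne (Matrix.ext fun i j => ?_)
    have hp : ∀ i, p i = o := fun i => sub_eq_zero.1 (norm_eq_zero.1 (hdist i))
    rw [h, hp i, hp j]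
    simp
  have hDw : D *ᵥ w = fun _ => 2 * ρ' ^ 2 := by
    ext i
    rw [h.mulVec_apply o]
    simp only [hdist, smul_sub, Finset.sum_sub_distrib, ← Finset.sum_smul, ← Finset.sum_mul, hw,
      ← hwo]
    simp
    ring
  refine le_antisymm (h.ker_le_affineDependencies (by positivity) hDw) fun x hx => ?_
  have h1 := h.mulVec_of_mem_affineDependencies o hx
  simp only [hdist, ← Finset.sum_mul, (mem_affineDependencies.1 hx).1, zero_mul] at h1
  exact h1

/-- If the squared norms are orthogonal to all affine dependencies, the points lie on a sphere. -/
theorem exists_dist_eq_of_affineDependencies [NeZero n]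
    (hp : ∀ x ∈ affineDependencies p, ∑ j, x j * ‖p j‖ ^ 2 = 0) :
    ∃ (c : EuclideanSpace ℝ (Fin r)) (ρ : ℝ), ∀ i, dist (p i) c = ρ := by
  let L : (Fin n → ℝ) →ₗ[ℝ] ℝ × EuclideanSpace ℝ (Fin r) :=
    (Fintype.linearCombination ℝ (fun _ : Fin n => (1 : ℝ))).prod (Fintype.linearCombination ℝ p)
  let f : Module.Dual ℝ (Fin n → ℝ) := Fintype.linearCombination ℝ fun j => ‖p j‖ ^ 2
  have hf : f ∈ LinearMap.range L.dualMap := by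
    rw [LinearMap.range_dualMap_eq_dualAnnihilator_ker, Submodule.mem_dualAnnihilator]
    intro x hx
    rw [LinearMap.ker_prod] at hx
    simpa [f, Fintype.linearCombination_apply] using hp x hx
  obtain ⟨g, hg⟩ := hf
  let φ : EuclideanSpace ℝ (Fin r) →L[ℝ] ℝ :=
    LinearMap.toContinuousLinearMap (g ∘ₗ LinearMap.inr ℝ ℝ _)
  let b := (InnerProductSpace.toDual ℝ _).symm φ
  have hb : ∀ v, ⟪b, v⟫_ℝ = g (0, v) := fun v => by
    simp [b, φ]
  have hi : ∀ i, ‖p i‖ ^ 2 = g (1, 0) + ⟪b, p i⟫_ℝ := by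
    intro i
    have h1 := LinearMap.congr_fun hg (Pi.single i 1)
    simp only [LinearMap.dualMap_apply, L, f, LinearMap.prod_apply,
      Fintype.linearCombination_apply_single, one_smul] at h1
    rw [← h1, hb, ← map_add]
    simp
  have hsq : ∀ i, dist (p i) ((2⁻¹ : ℝ) • b) ^ 2 = g (1, 0) + ‖(2⁻¹ : ℝ) • b‖ ^ 2 := by
    intro i
    rw [dist_eq_norm, norm_sub_sq_real, hi, inner_smul_right, real_inner_comm]
    ring
  exact ⟨(2⁻¹ : ℝ) • b, dist (p 0) ((2⁻¹ : ℝ) • b), fun i =>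
    (sq_eq_sq₀ dist_nonneg dist_nonneg).1 ((hsq i).trans (hsq 0).symm)⟩

end Gen

theorem spherical_iff_rank_eq {n r : ℕ}
    (D : Matrix (Fin n) (Fin n) ℝ) (hD : IsEDMOfDim D r) (hne : D ≠ 0) :
    IsSphericalEDM D ↔ D.rank = r + 1 := by
  have hn : NeZero n := ⟨by rintro rfl; exact hne (Subsingleton.elim _ _)⟩
  obtain ⟨m, p, hp, hr⟩ := hD
  rw [direction_affineSpan] at hr
  have hdep := finrank_affineDependencies_add p
  have hrank := D.mulVecLin.finrank_range_add_finrank_ker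
  rw [Module.finrank_fin_fun] at hrank
  change D.rank + _ = n at hrank
  constructor
  · rintro ⟨k, q, hq, c, ρ, hc⟩
    rw [hq.ker_eq_affineDependencies_of_dist_eq hne hc, ← hp.affineDependencies_eq hq] at hrank
    omega
  · intro hrk
    refine ⟨m, p, hp, exists_dist_eq_of_affineDependencies fun x hx => ?_⟩
    by_contra hx0
    have hDx := hp.mulVec_of_mem_affineDependencies 0 hx
    simp only [sub_zero] at hDx
    have hle := hp.ker_le_affineDependencies hx0 hDx
    have heq := Submodule.eq_of_le_of_finrank_eq hle (by omega)
    rw [← heq, LinearMap.mem_ker, Matrix.mulVecLin_apply, hDx] at hx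
    exact hx0 (congrFun hx 0)
end
end

section
/- Let D ≠ 0 be an n×n Euclidean distance matrix of embedding dimension r, and let P be an n×r configuration matrix of D with Pᵀe = 0 (i.e., the rows p^1,…,p^n of P generate D and have centroid at the origin, and they affinely span ℝ^r). Then D is spherical if and only if there exists a vector a ∈ ℝ^r such that P a = ½ J diag(T(D)), where diag(T(D)) is the vector of diagonal entries of T(D). -/
open Matrix

noncomputable section

/-- The centering matrix `J = I - E/n`. -/
def Jmat (n : ℕ) : Matrix (Fin n) (Fin n) ℝ := 1 - (n : ℝ)⁻¹ • onesMat n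

/-- The map `T(D) = -½ J D J`. -/
def Tmat {n : ℕ} (D : Matrix (Fin n) (Fin n) ℝ) : Matrix (Fin n) (Fin n) ℝ :=
  (-(1 / 2 : ℝ)) • (Jmat n * D * Jmat n)

theorem Jmat_mulVec_apply {n : ℕ} (v : Fin n → ℝ) (i : Fin n) :
    (Jmat n *ᵥ v) i = v i - (n : ℝ)⁻¹ * ∑ k, v k := by
  rw [Jmat, sub_mulVec, one_mulVec, smul_mulVec]
  simp [onesMat, mulVec, dotProduct]

theorem Jmat_mul_apply {n : ℕ} (M : Matrix (Fin n) (Fin n) ℝ) (i j : Fin n) :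
    (Jmat n * M) i j = M i j - (n : ℝ)⁻¹ * ∑ k, M k j := by
  rw [Jmat, sub_mul, one_mul, Matrix.smul_mul]
  simp [onesMat, Matrix.mul_apply]

theorem mul_Jmat_apply {n : ℕ} (M : Matrix (Fin n) (Fin n) ℝ) (i j : Fin n) :
    (M * Jmat n) i j = M i j - (n : ℝ)⁻¹ * ∑ k, M i k := by
  rw [Jmat, mul_sub, mul_one, Matrix.mul_smul]
  simp [onesMat, Matrix.mul_apply]

/-- For a centered configuration generating `D`, `T(D)` is the Gram matrix. -/
theorem Tmat_apply_eq_inner {n r : ℕ} {D : Matrix (Fin n) (Fin n) ℝ}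
    {x : Fin n → EuclideanSpace ℝ (Fin r)} (hx : IsEDMGen D x) (h0 : ∑ i, x i = 0)
    (i j : Fin n) : Tmat D i j = inner ℝ (x i) (x j) := by
  have hn : (n : ℝ) ≠ 0 := by
    have := i.pos
    positivity
  have hD : ∀ k l, D k l = ‖x k‖ ^ 2 - 2 * inner ℝ (x k) (x l) + ‖x l‖ ^ 2 := fun k l => by
    rw [hx k l, norm_sub_sq_real]
  have hrow : ∀ l, ∑ k, D l k = n * ‖x l‖ ^ 2 + ∑ k, ‖x k‖ ^ 2 := fun l => by
    simp [hD, Finset.sum_add_distrib, ← Finset.mul_sum, ← inner_sum, h0]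
  have hcol : ∀ l, ∑ k, D k l = n * ‖x l‖ ^ 2 + ∑ k, ‖x k‖ ^ 2 := fun l => by
    simp [hD, Finset.sum_add_distrib, ← Finset.mul_sum, ← sum_inner, h0, add_comm]
  simp only [Tmat, Matrix.smul_apply, mul_Jmat_apply, Jmat_mul_apply, Finset.sum_sub_distrib,
    Finset.sum_add_distrib, ← Finset.mul_sum, Finset.sum_const, Finset.card_univ, Fintype.card_fin,
    nsmul_eq_mul, hrow, hcol, hD i j, smul_eq_mul]
  field_simp
  ring

/-- Equidistance of the `x i` from `c`, summed over a centered configuration, determines the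
inner products with `c`. -/
theorem inner_eq_of_dist_eq {n r : ℕ} {x : Fin n → EuclideanSpace ℝ (Fin r)}
    (h0 : ∑ i, x i = 0) {c : EuclideanSpace ℝ (Fin r)} {ρ : ℝ} (hc : ∀ i, dist (x i) c = ρ)
    (i : Fin n) :
    inner ℝ (x i) c = 1 / 2 * (‖x i‖ ^ 2 - (n : ℝ)⁻¹ * ∑ k, ‖x k‖ ^ 2) := by
  have hn : (n : ℝ) ≠ 0 := by
    have := i.pos
    positivity
  have hsq : ∀ k, ‖x k‖ ^ 2 = 2 * inner ℝ (x k) c + (ρ ^ 2 - ‖c‖ ^ 2) := fun k => by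
    rw [← hc k, dist_eq_norm, norm_sub_sq_real]
    ring
  have hsum : ∑ k, ‖x k‖ ^ 2 = n * (ρ ^ 2 - ‖c‖ ^ 2) := by
    simp only [hsq, Finset.sum_add_distrib, ← Finset.mul_sum, ← sum_inner, h0]
    simp [mul_sub]
  rw [hsum, inv_mul_cancel_left₀ hn]
  linarith [hsq i]

/-- If two finite families have the same Gram matrix, every functional `inner · c` on the first
is realized on the second. -/
theorem exists_inner_eq_of_gram_eq {ι E F : Type*} [Fintype ι] [NormedAddCommGroup E]
    [InnerProductSpace ℝ E] [FiniteDimensional ℝ E] [NormedAddCommGroup F]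
    [InnerProductSpace ℝ F] {x : ι → E} {y : ι → F}
    (h : ∀ i j, inner ℝ (x i) (x j) = inner ℝ (y i) (y j)) (c : E) :
    ∃ a : F, ∀ i, inner ℝ (y i) a = inner ℝ (x i) c := by
  set S := Submodule.span ℝ (Set.range x)
  obtain ⟨w, hw⟩ := (Submodule.mem_span_range_iff_exists_fun ℝ).1 (S.starProjection_apply_mem c)
  refine ⟨∑ j, w j • y j, fun i => ?_⟩
  have hi : x i ∈ S := Submodule.subset_span ⟨i, rfl⟩
  have horth := S.starProjection_inner_eq_zero c (x i) hi
  rw [inner_sub_left, sub_eq_zero, ← hw, real_inner_comm] at horth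
  rw [horth, real_inner_comm]
  simp only [sum_inner, real_inner_smul_left, h]

theorem spherical_iff_exists_center_vector {n r : ℕ}
    (D : Matrix (Fin n) (Fin n) ℝ) (hne : D ≠ 0)
    (P : Matrix (Fin n) (Fin r) ℝ)
    (hgen : IsEDMGen D (fun i => (EuclideanSpace.equiv (Fin r) ℝ).symm (P i)))
    (hPe : Pᵀ *ᵥ (fun _ => (1 : ℝ)) = 0)
    (hspan : affineSpan ℝ
      (Set.range fun i => (EuclideanSpace.equiv (Fin r) ℝ).symm (P i)) = ⊤) :
    IsSphericalEDM D ↔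
      ∃ a : Fin r → ℝ,
        P *ᵥ a = (1 / 2 : ℝ) • (Jmat n *ᵥ fun i => Tmat D i i) := by
  set p : Fin n → EuclideanSpace ℝ (Fin r) :=
    fun i => (EuclideanSpace.equiv (Fin r) ℝ).symm (P i) with hp
  have hp0 : ∑ i, p i = 0 := by
    ext k
    rw [WithLp.ofLp_sum, Finset.sum_apply]
    simpa [hp, mulVec, dotProduct] using congrFun hPe k
  have hinner : ∀ (a : EuclideanSpace ℝ (Fin r)) i, (P *ᵥ a.ofLp) i = inner ℝ (p i) a :=
    fun a i => by simp [hp, mulVec, dotProduct, PiLp.inner_apply, mul_comm]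
  have hrhs : ∀ i, ((1 / 2 : ℝ) • (Jmat n *ᵥ fun i => Tmat D i i)) i =
      1 / 2 * (‖p i‖ ^ 2 - (n : ℝ)⁻¹ * ∑ k, ‖p k‖ ^ 2) := fun i => by
    simp only [Pi.smul_apply, smul_eq_mul, Jmat_mulVec_apply, Tmat_apply_eq_inner hgen hp0,
      real_inner_self_eq_norm_sq]
  constructor
  · rintro ⟨s, q, hq, c, ρ, hc⟩
    set m := (n : ℝ)⁻¹ • ∑ i, q i with hm
    have hx : IsEDMGen D fun i => q i - m := fun i j => by
      rw [hq i j, sub_sub_sub_cancel_right]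
    have hx0 : ∑ i, (q i - m) = 0 := by
      rcases Nat.eq_zero_or_pos n with rfl | hn
      · simp
      · have : (n : ℝ) ≠ 0 := by positivity
        simp [hm, ← Nat.cast_smul_eq_nsmul ℝ, smul_smul, this]
    have hgram : ∀ i j, inner ℝ (q i - m) (q j - m) = inner ℝ (p i) (p j) := fun i j => by
      rw [← Tmat_apply_eq_inner hx hx0, Tmat_apply_eq_inner hgen hp0]
    have hnorm : ∀ i, ‖q i - m‖ ^ 2 = ‖p i‖ ^ 2 := fun i => by
      rw [← real_inner_self_eq_norm_sq, hgram, real_inner_self_eq_norm_sq]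
    obtain ⟨a, ha⟩ := exists_inner_eq_of_gram_eq hgram (c - m)
    refine ⟨a.ofLp, funext fun i => ?_⟩
    rw [hinner, hrhs, ha, inner_eq_of_dist_eq hx0 (c := c - m) (ρ := ρ)
      (fun k => by rw [dist_sub_right, hc]) i]
    simp only [hnorm]
  · rintro ⟨a, ha⟩
    refine ⟨r, p, hgen, WithLp.toLp 2 a,
      √((n : ℝ)⁻¹ * ∑ k, ‖p k‖ ^ 2 + ‖WithLp.toLp 2 a‖ ^ 2), fun i => ?_⟩
    have hi := congrFun ha i
    rw [hrhs, hinner (WithLp.toLp 2 a)] at hi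
    rw [dist_eq_norm, ← Real.sqrt_sq (norm_nonneg _), norm_sub_sq_real, hi]
    congr 1
    ring
end
end

section
/- Let D be an n×n spherical Euclidean distance matrix of embedding dimension r, generated by points p^1,…,p^n in ℝ^r whose centroid is at the origin and which affinely span ℝ^r, and let P be the n×r configuration matrix with i-th row (p^i)ᵀ. Then the points lie on a hypersphere centered at a = (1/(2n)) (PᵀP)^{-1} Pᵀ D e, where e is the all-ones vector in ℝ^n. -/
open Matrix

noncomputable section

open scoped RealInnerProductSpace

section Centered

variable {ι E F : Type*} [Fintype ι]
  [NormedAddCommGroup E] [InnerProductSpace ℝ E] [NormedAddCommGroup F] [InnerProductSpace ℝ F]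

theorem sum_norm_sub_sq_of_sum_eq_zero {p : ι → E} (hp : ∑ i, p i = 0) (x : E) :
    ∑ j, ‖x - p j‖ ^ 2 = Fintype.card ι * ‖x‖ ^ 2 + ∑ j, ‖p j‖ ^ 2 := by
  simp_rw [norm_sub_sq_real, Finset.sum_add_distrib, Finset.sum_sub_distrib, ← Finset.mul_sum,
    ← inner_sum, hp]
  simp

theorem norm_sq_eq_of_norm_sub_sq_eq {p : ι → E} {q : ι → F}
    (hp : ∑ i, p i = 0) (hq : ∑ i, q i = 0)
    (h : ∀ i j, ‖p i - p j‖ ^ 2 = ‖q i - q j‖ ^ 2) (i : ι) : ‖p i‖ ^ 2 = ‖q i‖ ^ 2 := by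
  have : Nonempty ι := ⟨i⟩
  have hn : (Fintype.card ι : ℝ) ≠ 0 := by simp
  have hrow (i : ι) : Fintype.card ι * ‖p i‖ ^ 2 + ∑ j, ‖p j‖ ^ 2 =
      Fintype.card ι * ‖q i‖ ^ 2 + ∑ j, ‖q j‖ ^ 2 := by
    rw [← sum_norm_sub_sq_of_sum_eq_zero hp, ← sum_norm_sub_sq_of_sum_eq_zero hq]
    exact Finset.sum_congr rfl fun j _ => h i j
  have htot := Finset.sum_congr (rfl : (Finset.univ : Finset ι) = _) fun i _ => hrow i
  simp only [Finset.sum_add_distrib, ← Finset.mul_sum, Finset.sum_const, Finset.card_univ,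
    nsmul_eq_mul] at htot
  have hs : ∑ j, ‖p j‖ ^ 2 = ∑ j, ‖q j‖ ^ 2 := mul_left_cancel₀ hn (by linarith)
  exact mul_left_cancel₀ hn (by linarith [hrow i])

theorem inner_eq_of_norm_sub_sq_eq {p : ι → E} {q : ι → F}
    (hp : ∑ i, p i = 0) (hq : ∑ i, q i = 0)
    (h : ∀ i j, ‖p i - p j‖ ^ 2 = ‖q i - q j‖ ^ 2) (i j : ι) : ⟪p i, p j⟫ = ⟪q i, q j⟫ := by
  have hij := h i j
  rw [norm_sub_sq_real, norm_sub_sq_real, norm_sq_eq_of_norm_sub_sq_eq hp hq h i,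
    norm_sq_eq_of_norm_sub_sq_eq hp hq h j] at hij
  linarith

end Centered

section Matrices

variable {ι κ l : Type*} [Fintype ι] [Fintype κ] [Fintype l] [DecidableEq κ]

theorem mul_inv_mul_transpose_mul_eq_of_gram_eq {P : Matrix ι κ ℝ} {Q : Matrix ι l ℝ}
    (hP : IsUnit (Pᵀ * P)) (h : P * Pᵀ = Q * Qᵀ) : P * (Pᵀ * P)⁻¹ * Pᵀ * Q = Q := by
  classical
  have hz : (P * (Pᵀ * P)⁻¹ * Pᵀ - 1) * (Q * Qᴴ) = 0 := by
    rw [conjTranspose_eq_transpose_of_trivial, ← h, ← Matrix.mul_assoc, Matrix.sub_mul,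
      Matrix.mul_assoc (P * (Pᵀ * P)⁻¹), Matrix.mul_assoc P,
      Matrix.nonsing_inv_mul _ ((Matrix.isUnit_iff_isUnit_det _).mp hP)]
    simp
  rw [Matrix.mul_self_mul_conjTranspose_eq_zero, Matrix.sub_mul, Matrix.one_mul] at hz
  exact sub_eq_zero.mp hz

theorem isUnit_transpose_mul_self_of_affineSpan_eq_top {p : ι → EuclideanSpace ℝ κ}
    (hspan : affineSpan ℝ (Set.range p) = ⊤) :
    IsUnit ((Matrix.of fun i k => p i k)ᵀ * Matrix.of fun i k => p i k) := by
  rw [← conjTranspose_eq_transpose_of_trivial]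
  refine (Matrix.PosDef.conjTranspose_mul_self _ ?_).isUnit
  refine (injective_iff_map_eq_zero (Matrix.mulVecLin _)).mpr fun x hx => ?_
  have horth : ∀ y ∈ affineSpan ℝ (Set.range p), ⟪y, WithLp.toLp 2 x⟫ = 0 := by
    intro y hy
    refine Submodule.span_induction ?_ ?_ ?_ ?_ (affineSpan_le_toAffineSubspace_span hy)
    · rintro _ ⟨i, rfl⟩
      have := congrFun hx i
      simpa [Matrix.mulVec, dotProduct, PiLp.inner_apply, mul_comm] using this
    · simp
    · intro u v _ _ hu hv
      rw [inner_add_left, hu, hv, add_zero]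
    · intro t u _ hu
      rw [real_inner_smul_left, hu, mul_zero]
  have := horth (WithLp.toLp 2 x) (hspan ▸ AffineSubspace.mem_top ℝ _ _)
  simpa using this

end Matrices

/-- A spherical EDM has a centered generating configuration on a sphere. -/
theorem IsSphericalEDM.exists_centered {n : ℕ} {D : Matrix (Fin n) (Fin n) ℝ}
    (hD : IsSphericalEDM D) :
    ∃ (s : ℕ) (q : Fin n → EuclideanSpace ℝ (Fin s)), IsEDMGen D q ∧ ∑ i, q i = 0 ∧
      ∃ (c : EuclideanSpace ℝ (Fin s)) (ρ : ℝ), ∀ i, dist (q i) c = ρ := by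
  obtain ⟨s, q, hq, c, ρ, hc⟩ := hD
  set m : EuclideanSpace ℝ (Fin s) := (n : ℝ)⁻¹ • ∑ i, q i with hm
  refine ⟨s, fun i => q i - m, fun i j => by simpa using hq i j, ?_, c - m, ρ,
    fun i => by simpa using hc i⟩
  rcases Nat.eq_zero_or_pos n with rfl | hn
  · simp
  · have hn' : (n : ℝ) ≠ 0 := by positivity
    rw [Finset.sum_sub_distrib, Finset.sum_const, Finset.card_univ, Fintype.card_fin,
      ← Nat.cast_smul_eq_nsmul ℝ, hm, smul_inv_smul₀ hn', sub_self]

theorem center_formula {n r : ℕ}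
    (D : Matrix (Fin n) (Fin n) ℝ) (hsph : IsSphericalEDM D)
    (p : Fin n → EuclideanSpace ℝ (Fin r))
    (hgen : IsEDMGen D p)
    (hcent : ∑ i, p i = 0)
    (hspan : affineSpan ℝ (Set.range p) = ⊤)
    (P : Matrix (Fin n) (Fin r) ℝ) (hP : P = Matrix.of fun i k => p i k) :
    ∃ ρ : ℝ, ∀ i,
      dist (p i)
        ((EuclideanSpace.equiv (Fin r) ℝ).symm
          ((1 / (2 * (n : ℝ))) • ((Pᵀ * P)⁻¹ *ᵥ (Pᵀ *ᵥ (D *ᵥ fun _ => (1 : ℝ)))))) = ρ := by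
  rcases Nat.eq_zero_or_pos n with rfl | hn
  · exact ⟨0, fun i => i.elim0⟩
  obtain ⟨s, q, hq, hq0, c, ρ, hc⟩ := hsph.exists_centered
  have hpq : ∀ i j, ‖p i - p j‖ ^ 2 = ‖q i - q j‖ ^ 2 := fun i j => by rw [← hgen, hq]
  have hnorm := norm_sq_eq_of_norm_sub_sq_eq hcent hq0 hpq
  have hunit : IsUnit (Pᵀ * P) := hP ▸ isUnit_transpose_mul_self_of_affineSpan_eq_top hspan
  let Q : Matrix (Fin n) (Fin s) ℝ := Matrix.of fun i k => q i k
  have hgram : P * Pᵀ = Q * Qᵀ := by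
    ext i j
    simpa [hP, Q, Matrix.mul_apply, PiLp.inner_apply, mul_comm] using
      inner_eq_of_norm_sub_sq_eq hcent hq0 hpq i j
  have hQc (i : Fin n) : (Q *ᵥ c.ofLp) i = ⟪q i, c⟫ := by
    simp [Q, Matrix.mulVec, dotProduct, PiLp.inner_apply, mul_comm]
  have hsphere (i : Fin n) : ‖q i‖ ^ 2 = 2 * ⟪q i, c⟫ + (ρ ^ 2 - ‖c‖ ^ 2) := by
    rw [← hc i, dist_eq_norm, norm_sub_sq_real]
    ring
  have hDe : (D *ᵥ fun _ => (1 : ℝ)) = (2 * (n : ℝ)) • (Q *ᵥ c.ofLp) +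
      (n * (ρ ^ 2 - ‖c‖ ^ 2) + ∑ j, ‖q j‖ ^ 2) • fun _ => (1 : ℝ) := by
    ext i
    have hrow := sum_norm_sub_sq_of_sum_eq_zero hq0 (q i)
    simp only [← hq i, Fintype.card_fin] at hrow
    have hrow' : (D *ᵥ fun _ => (1 : ℝ)) i = ∑ j, D i j := by simp [Matrix.mulVec, dotProduct]
    simp only [Pi.add_apply, Pi.smul_apply, hQc, smul_eq_mul, mul_one]
    rw [hrow', hrow, hsphere i]
    ring
  have hPe : (Pᵀ *ᵥ fun _ => (1 : ℝ)) = 0 := by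
    ext k
    simpa [hP, Matrix.mulVec, dotProduct] using congrArg (fun v => v.ofLp k) hcent
  set a : Fin r → ℝ := (1 / (2 * (n : ℝ))) • ((Pᵀ * P)⁻¹ *ᵥ (Pᵀ *ᵥ (D *ᵥ fun _ => (1 : ℝ))))
    with ha
  have hPa : P *ᵥ a = Q *ᵥ c.ofLp := by
    rw [ha, hDe, Matrix.mulVec_add, Matrix.mulVec_smul Pᵀ (2 * (n : ℝ)),
      Matrix.mulVec_smul Pᵀ _ (fun _ => (1 : ℝ)), hPe, smul_zero, add_zero, Matrix.mulVec_smul,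
      Matrix.mulVec_smul, Matrix.mulVec_smul, smul_smul, one_div_mul_cancel (by positivity),
      one_smul]
    simp only [Matrix.mulVec_mulVec, ← Matrix.mul_assoc]
    rw [mul_inv_mul_transpose_mul_eq_of_gram_eq hunit hgram]
  have hinner (i : Fin n) : ⟪p i, WithLp.toLp 2 a⟫ = ⟪q i, c⟫ := by
    rw [← hQc, ← hPa]
    simp [hP, Matrix.mulVec, dotProduct, PiLp.inner_apply, mul_comm]
  refine ⟨√(ρ ^ 2 - ‖c‖ ^ 2 + ‖WithLp.toLp 2 a‖ ^ 2), fun i => ?_⟩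
  change dist (p i) (WithLp.toLp 2 a) = _
  rw [dist_eq_norm, ← Real.sqrt_sq (norm_nonneg (p i - _)), norm_sub_sq_real, hinner, hnorm,
    hsphere]
  ring_nf
end
end

section
/- Let D be an n×n Euclidean distance matrix. Then D is regular (i.e., generated by points that lie on a hypersphere centered at the centroid of those points) if and only if the all-ones vector e is an eigenvector of D. -/
open Matrix

noncomputable section

/-- `D` is a regular EDM: it is generated by points lying on a hypersphere
centered at the centroid of the points. -/
def IsRegularEDM {n : ℕ} (D : Matrix (Fin n) (Fin n) ℝ) : Prop :=
  ∃ (r : ℕ) (p : Fin n → EuclideanSpace ℝ (Fin r)), IsEDMGen D p ∧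
    ∃ ρ : ℝ, ∀ i, dist (p i) ((n : ℝ)⁻¹ • ∑ j, p j) = ρ

/-- The sum of the squared distances from `x` to the points `p j` splits into `n` times the squared
distance from `x` to the centroid and the sum of squared distances from the points to the
centroid. -/
theorem sum_norm_sub_sq_eq_centroid {E : Type*} [NormedAddCommGroup E] [InnerProductSpace ℝ E]
    {n : ℕ} (hn : 0 < n) (p : Fin n → E) (x : E) :
    ∑ j, ‖x - p j‖ ^ 2 = n * ‖x - (n : ℝ)⁻¹ • ∑ j, p j‖ ^ 2
      + ∑ j, ‖p j - (n : ℝ)⁻¹ • ∑ j, p j‖ ^ 2 := by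
  have hn' : (n : ℝ) ≠ 0 := by positivity
  set c := (n : ℝ)⁻¹ • ∑ j, p j with hc
  have hsum : ∑ j, (p j - c) = 0 := by
    rw [Finset.sum_sub_distrib, Finset.sum_const, Finset.card_univ, Fintype.card_fin, hc,
      ← Nat.cast_smul_eq_nsmul ℝ, smul_inv_smul₀ hn', sub_self]
  have hterm : ∀ j, ‖x - p j‖ ^ 2
      = ‖x - c‖ ^ 2 - 2 * inner ℝ (x - c) (p j - c) + ‖p j - c‖ ^ 2 := fun j => by
    rw [← norm_sub_sq_real, sub_sub_sub_cancel_right]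
  simp only [hterm, Finset.sum_add_distrib, Finset.sum_sub_distrib, ← Finset.mul_sum, ← inner_sum,
    hsum, inner_zero_right]
  simp

theorem IsEDMGen.mulVec_one {n r : ℕ} (hn : 0 < n) {D : Matrix (Fin n) (Fin n) ℝ}
    {p : Fin n → EuclideanSpace ℝ (Fin r)} (hp : IsEDMGen D p) (i : Fin n) :
    (D *ᵥ (fun _ => (1 : ℝ))) i = n * dist (p i) ((n : ℝ)⁻¹ • ∑ j, p j) ^ 2
      + ∑ j, ‖p j - (n : ℝ)⁻¹ • ∑ j, p j‖ ^ 2 := by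
  rw [dist_eq_norm, ← sum_norm_sub_sq_eq_centroid hn p (p i)]
  simp only [mulVec, dotProduct, mul_one]
  exact Finset.sum_congr rfl fun j _ => hp i j

theorem regular_iff_allOnes_eigenvector {n : ℕ} (hn : 0 < n)
    (D : Matrix (Fin n) (Fin n) ℝ) (hD : IsEDM D) :
    IsRegularEDM D ↔ ∃ μ : ℝ, D *ᵥ (fun _ => (1 : ℝ)) = μ • (fun _ => (1 : ℝ)) := by
  constructor
  · rintro ⟨r, p, hp, ρ, hρ⟩
    refine ⟨n * ρ ^ 2 + ∑ j, ‖p j - (n : ℝ)⁻¹ • ∑ j, p j‖ ^ 2, funext fun i => ?_⟩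
    rw [hp.mulVec_one hn, hρ, Pi.smul_apply, smul_eq_mul, mul_one]
  · rintro ⟨μ, hμ⟩
    obtain ⟨r, p, hp⟩ := hD
    refine ⟨r, p, hp, dist (p ⟨0, hn⟩) ((n : ℝ)⁻¹ • ∑ j, p j), fun i => ?_⟩
    have hn' : (n : ℝ) ≠ 0 := by positivity
    have h : (D *ᵥ (fun _ => (1 : ℝ))) i = (D *ᵥ (fun _ => (1 : ℝ))) ⟨0, hn⟩ := by
      rw [hμ, Pi.smul_apply, Pi.smul_apply]
    rw [hp.mulVec_one hn, hp.mulVec_one hn, add_left_inj, mul_right_inj' hn'] at h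
    exact (sq_eq_sq₀ dist_nonneg dist_nonneg).1 h
end
end
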